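/- First Stokeslet difference term along the centerline: there exist constants C > 0 and ε₀ > 0, depending only on c_Γ and κ_max, such that for all 0 < ε < ε₀, 0 < δ < ε₀, every f ∈ C¹(ℝ/ℤ; ℝ³), and every s ∈ ℝ/ℤ, the quantity I₁ = ∫_{−1/2}^{1/2} ( 1/(|X̄(s,s̄)|² + δ²)^{1/2} − 1/(|X̄(s,s̄)|² + ε²)^{1/2} ) f(s − s̄) ds̄ satisfies |I₁ + log(δ²/ε²) f(s)| ≤ C (ε|log ε| + δ|log δ|) ‖f‖_{C¹}. -/

import Mathlib

open MeasureTheory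

noncomputable section

local notation "⟪" x ", " y "⟫" => @inner ℝ _ _ x y

abbrev V3 : Type := EuclideanSpace ℝ (Fin 3)

/-- The `C⁰` (sup) norm of a function `ℝ/ℤ → ℝ³`. -/
def C0norm (f : ℝ → V3) : ℝ := ⨆ s : ℝ, ‖f s‖

/-- The `C¹` norm of a function `ℝ/ℤ → ℝ³`. -/
def C1norm (f : ℝ → V3) : ℝ := C0norm f + C0norm (deriv f)

/-- The radial unit vector `e_ρ(s,θ) = cos θ e_{n1}(s) + sin θ e_{n2}(s)`. -/
def ePerp (en1 en2 : ℝ → V3) (s θ : ℝ) : V3 :=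
  Real.cos θ • en1 s + Real.sin θ • en2 s

/-- `R(s, s̄, θ) = X(s) + ε e_ρ(s,θ) − X(s − s̄)`. -/
def Rvec (X en1 en2 : ℝ → V3) (ε s sb θ : ℝ) : V3 :=
  X s + ε • ePerp en1 en2 s θ - X (s - sb)

/-- The slender-body geometry hypotheses: `X : ℝ/ℤ → ℝ³` is a `C²` closed curve
parameterized by arclength, non-self-intersecting with constant `cΓ`, with curvature
bounded by `κmax`, together with a `C¹` orthonormal frame `(X', en1, en2)`. -/
structure SlenderGeom (cΓ κmax : ℝ) (X en1 en2 : ℝ → V3) : Prop where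
  smooth : ContDiff ℝ 2 X
  periodicX : ∀ s, X (s + 1) = X s
  arclength : ∀ s, ‖deriv X s‖ = 1
  no_self_intersect : ∀ s t : ℝ, |s - t| ≤ 1 / 2 → cΓ * |s - t| ≤ ‖X s - X t‖
  curvature_max : ∀ s, ‖deriv (deriv X) s‖ ≤ κmax
  en1_smooth : ContDiff ℝ 1 en1
  en2_smooth : ContDiff ℝ 1 en2
  en1_periodic : ∀ s, en1 (s + 1) = en1 s
  en2_periodic : ∀ s, en2 (s + 1) = en2 s
  en1_unit : ∀ s, ‖en1 s‖ = 1
  en2_unit : ∀ s, ‖en2 s‖ = 1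
  es_en1 : ∀ s, ⟪deriv X s, en1 s⟫ = 0
  es_en2 : ∀ s, ⟪deriv X s, en2 s⟫ = 0
  en1_en2 : ∀ s, ⟪en1 s, en2 s⟫ = 0

/-- The singular Stokeslet `S(y) v = v/|y| + (y·v) y/|y|³`. -/
def stokeslet (y v : V3) : V3 := ‖y‖⁻¹ • v + (‖y‖ ^ 3)⁻¹ • ⟪y, v⟫ • y

/-- The singular doublet `D(y) v = v/|y|³ − 3 (y·v) y/|y|⁵`. -/
def doubletK (y v : V3) : V3 := (‖y‖ ^ 3)⁻¹ • v - (3 * (‖y‖ ^ 5)⁻¹) • ⟪y, v⟫ • y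

/-- The regularized Stokeslet `S_δ(y) v`. -/
def stokesletReg (δ : ℝ) (y v : V3) : V3 :=
  ((‖y‖ ^ 2 + δ ^ 2) ^ ((1 : ℝ) / 2))⁻¹ • v
    + ((‖y‖ ^ 2 + δ ^ 2) ^ ((3 : ℝ) / 2))⁻¹ • (⟪y, v⟫ • y + δ ^ 2 • v)

/-- The regularized doublet `D_δ(y) v`. -/
def doubletReg (δ : ℝ) (y v : V3) : V3 :=
  ((‖y‖ ^ 2 + δ ^ 2) ^ ((3 : ℝ) / 2))⁻¹ • v
    - (3 * ((‖y‖ ^ 2 + δ ^ 2) ^ ((5 : ℝ) / 2))⁻¹) • (⟪y, v⟫ • y + δ ^ 2 • v)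

/-- The classical slender-body velocity `u^SB(x)` with doublet coefficient `ε²/2`. -/
def uSB (X f : ℝ → V3) (ε : ℝ) (x : V3) : V3 :=
  (8 * Real.pi)⁻¹ • ∫ t in (0:ℝ)..1,
    (stokeslet (x - X t) (f t) + (ε ^ 2 / 2) • doubletK (x - X t) (f t))

/-- The regularized slender-body velocity with doublet coefficient `β`. -/
def uReg (X f : ℝ → V3) (β δ : ℝ) (x : V3) : V3 :=
  (8 * Real.pi)⁻¹ • ∫ t in (0:ℝ)..1,
    (stokesletReg δ (x - X t) (f t) + β • doubletReg δ (x - X t) (f t))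

/-- The Keller–Rubinow classical centerline velocity `u^SB_C(X(s))`. -/
def uSBC (X f : ℝ → V3) (ε s : ℝ) : V3 :=
  (8 * Real.pi)⁻¹ •
    ((f s - (3 : ℝ) • ⟪deriv X s, f s⟫ • deriv X s
        - (2 * Real.log (Real.pi * ε / 4)) • (f s + ⟪deriv X s, f s⟫ • deriv X s))
      + ∫ t in (0:ℝ)..1,
          ((‖X s - X t‖⁻¹ • f t
              + (‖X s - X t‖ ^ 3)⁻¹ • ⟪X s - X t, f t⟫ • (X s - X t))
            - |Real.sin (Real.pi * (s - t)) / Real.pi|⁻¹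
                • (f s + ⟪deriv X s, f s⟫ • deriv X s)))

/-- The regularized pressure `p^δ(x)`. -/
def pReg (X f : ℝ → V3) (δ : ℝ) (x : V3) : ℝ :=
  (4 * Real.pi)⁻¹ * ∫ t in (0:ℝ)..1,
    (⟪x - X t, f t⟫ * ((‖x - X t‖ ^ 2 + δ ^ 2) ^ ((3 : ℝ) / 2))⁻¹
      + 3 * δ ^ 2 * ⟪x - X t, f t⟫ * (2 * (‖x - X t‖ ^ 2 + δ ^ 2) ^ ((5 : ℝ) / 2))⁻¹)

/-- The symmetric strain tensor `E(u) = (∇u + (∇u)ᵀ)/2` applied to the vector `n`. -/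
def strainApply (u : V3 → V3) (x n : V3) : V3 :=
  (2 : ℝ)⁻¹ • (fderiv ℝ u x n + gradient (fun y => ⟪u y, n⟫) x)

/-- The surface Jacobian `J_ε(s,θ) = ε(1 − ε(κ₁ cos θ + κ₂ sin θ))`. -/
def Jfac (X en1 en2 : ℝ → V3) (ε s θ : ℝ) : ℝ :=
  ε * (1 - ε * (⟪deriv (deriv X) s, en1 s⟫ * Real.cos θ
      + ⟪deriv (deriv X) s, en2 s⟫ * Real.sin θ))

/-- The regularized surface force density
`f^δ(s) = ∫_0^{2π} (2 E(u^δ) n − p^δ n) J_ε dθ`, with `n = −e_ρ`. -/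
def fReg (X en1 en2 f : ℝ → V3) (ε δ s : ℝ) : V3 :=
  ∫ θ in (0:ℝ)..(2 * Real.pi),
    Jfac X en1 en2 ε s θ •
      ((2 : ℝ) • strainApply (uReg X f ((ε ^ 2 + δ ^ 2) / 2) δ)
          (X s + ε • ePerp en1 en2 s θ) (-ePerp en1 en2 s θ)
        - pReg X f δ (X s + ε • ePerp en1 en2 s θ) • (-ePerp en1 en2 s θ))

/-- The vector field `d_n^δ[f](x)`. -/
def dReg (X f : ℝ → V3) (δ : ℝ) (n : ℕ) (x : V3) : V3 :=
  (8 * Real.pi)⁻¹ • ∫ t in (0:ℝ)..1,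
    (δ ^ 2 * ((‖x - X t‖ ^ 2 + δ ^ 2) ^ ((n : ℝ) / 2))⁻¹) • f t

/-- The scalar field `d_5^δ[f·R](x)`. -/
def dRegP (X f : ℝ → V3) (δ : ℝ) (x : V3) : ℝ :=
  (8 * Real.pi)⁻¹ * ∫ t in (0:ℝ)..1,
    δ ^ 2 * ⟪x - X t, f t⟫ * ((‖x - X t‖ ^ 2 + δ ^ 2) ^ ((5 : ℝ) / 2))⁻¹

/-- The extra force contribution
`F^δ(s) = ∫_0^{2π} (2E(d₃^δ[f])n − 3(ε²+δ²)E(d₅^δ[f])n − 3 d₅^δ[f·R] n) J_ε dθ`. -/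
def Fextra (X en1 en2 f : ℝ → V3) (ε δ s : ℝ) : V3 :=
  ∫ θ in (0:ℝ)..(2 * Real.pi),
    Jfac X en1 en2 ε s θ •
      ((2 : ℝ) • strainApply (dReg X f δ 3) (X s + ε • ePerp en1 en2 s θ)
          (-ePerp en1 en2 s θ)
        - (3 * (ε ^ 2 + δ ^ 2)) • strainApply (dReg X f δ 5)
            (X s + ε • ePerp en1 en2 s θ) (-ePerp en1 en2 s θ)
        - (3 * dRegP X f δ (X s + ε • ePerp en1 en2 s θ)) • (-ePerp en1 en2 s θ))

/-- The error made by regularizing the kernel `1/r` at scale `ε`. -/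
def regError (ε r : ℝ) : ℝ := r⁻¹ - (√(r ^ 2 + ε ^ 2))⁻¹

theorem regError_nonneg {ε r : ℝ} (hr : 0 < r) : 0 ≤ regError ε r := by
  have : r ≤ √(r ^ 2 + ε ^ 2) := Real.le_sqrt_of_sq_le (by nlinarith [sq_nonneg ε])
  exact sub_nonneg.2 (inv_anti₀ hr this)

theorem one_sub_div_sqrt_le {ε r : ℝ} (hr : 0 < r) :
    1 - r / √(r ^ 2 + ε ^ 2) ≤ ε ^ 2 / (r ^ 2 + ε ^ 2) := by
  have hpos : 0 < r ^ 2 + ε ^ 2 := by positivity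
  have hq : r ≤ √(r ^ 2 + ε ^ 2) := Real.le_sqrt_of_sq_le (by nlinarith [sq_nonneg ε])
  have hx0 : 0 ≤ r / √(r ^ 2 + ε ^ 2) := by positivity
  have hx1 : r / √(r ^ 2 + ε ^ 2) ≤ 1 := div_le_one_of_le₀ hq (by positivity)
  have hsq : (r / √(r ^ 2 + ε ^ 2)) ^ 2 = 1 - ε ^ 2 / (r ^ 2 + ε ^ 2) := by
    rw [div_pow, Real.sq_sqrt hpos.le]; field_simp; ring
  nlinarith

theorem sq_div_le_of_mul_le {c ε r t : ℝ} (hc : 0 < c) (hc1 : c ≤ 1) (ht : 0 < t)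
    (hrt : c * t ≤ r) :
    ε ^ 2 / (r ^ 2 + ε ^ 2) ≤ (c ^ 2)⁻¹ * (ε ^ 2 / (t ^ 2 + ε ^ 2)) := by
  have hle : c ^ 2 * (t ^ 2 + ε ^ 2) ≤ r ^ 2 + ε ^ 2 := by
    have h1 : (c * t) ^ 2 ≤ r ^ 2 := by gcongr
    have h2 : c ^ 2 ≤ 1 := pow_le_one₀ hc.le hc1
    nlinarith [sq_nonneg ε]
  calc ε ^ 2 / (r ^ 2 + ε ^ 2) ≤ ε ^ 2 / (c ^ 2 * (t ^ 2 + ε ^ 2)) := by gcongr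
    _ = (c ^ 2)⁻¹ * (ε ^ 2 / (t ^ 2 + ε ^ 2)) := by field_simp

theorem regError_mul_le {c ε r t : ℝ} (hc : 0 < c) (hc1 : c ≤ 1) (ht : 0 < t)
    (hrt : c * t ≤ r) :
    regError ε r * t ≤ (c ^ 3)⁻¹ * (ε ^ 2 / (t ^ 2 + ε ^ 2)) := by
  have hr : 0 < r := lt_of_lt_of_le (by positivity) hrt
  have h1 : regError ε r * t = (t / r) * (1 - r / √(r ^ 2 + ε ^ 2)) := by
    unfold regError; field_simp
  have h2 : t / r ≤ c⁻¹ := by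
    rw [div_le_iff₀ hr, inv_mul_eq_div, le_div_iff₀ hc]; linarith
  have h3 := (one_sub_div_sqrt_le (ε := ε) hr).trans (sq_div_le_of_mul_le hc hc1 ht hrt)
  calc regError ε r * t ≤ (t / r) * ((c ^ 2)⁻¹ * (ε ^ 2 / (t ^ 2 + ε ^ 2))) := by
        rw [h1]; gcongr
    _ ≤ c⁻¹ * ((c ^ 2)⁻¹ * (ε ^ 2 / (t ^ 2 + ε ^ 2))) := by gcongr
    _ = (c ^ 3)⁻¹ * (ε ^ 2 / (t ^ 2 + ε ^ 2)) := by field_simp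

theorem abs_regError_sub_le {ε r t : ℝ} (hr : 0 < r) (hrt : r ≤ t) :
    |regError ε r - regError ε t| ≤ (t - r) / (r * t) * (3 * (ε ^ 2 / (r ^ 2 + ε ^ 2))) := by
  have ht : 0 < t := hr.trans_le hrt
  have hx := one_sub_div_sqrt_le (ε := ε) hr
  set a := √(r ^ 2 + ε ^ 2) with ha
  set b := √(t ^ 2 + ε ^ 2) with hb
  have ha2 : a ^ 2 = r ^ 2 + ε ^ 2 := Real.sq_sqrt (by positivity)
  have hb2 : b ^ 2 = t ^ 2 + ε ^ 2 := Real.sq_sqrt (by positivity)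
  have ha0 : 0 < a := Real.sqrt_pos.2 (by positivity)
  have hb0 : 0 < b := Real.sqrt_pos.2 (by positivity)
  have hra : r ≤ a := Real.le_sqrt_of_sq_le (by nlinarith [sq_nonneg ε])
  have htb : t ≤ b := Real.le_sqrt_of_sq_le (by nlinarith [sq_nonneg ε])
  have hrbta : r / a ≤ t / b := by
    rw [div_le_div_iff₀ ha0 hb0]
    apply le_of_sq_le_sq _ (by positivity)
    rw [mul_pow, mul_pow, ha2, hb2]
    nlinarith [sq_nonneg ε, mul_self_le_mul_self hr.le hrt]
  have hdiff : regError ε r - regError ε t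
      = (t - r) / (r * t) * (1 - r / a * (t / b) * ((t + r) / (b + a))) := by
    have key : b - a = (t - r) * (t + r) / (b + a) := by
      rw [eq_div_iff (by positivity)]; nlinarith
    have : regError ε r - regError ε t = (t - r) / (r * t) - (b - a) / (a * b) := by
      simp only [regError, ← ha, ← hb]; field_simp; ring
    rw [this, key]; field_simp
  have hx0 : 0 ≤ r / a := by positivity
  have hx1 : r / a ≤ 1 := div_le_one_of_le₀ hra ha0.le
  have hy1 : t / b ≤ 1 := div_le_one_of_le₀ htb hb0.le
  have hz : r / a ≤ (t + r) / (b + a) := by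
    rw [div_le_div_iff₀ ha0 (by positivity)]
    rw [div_le_div_iff₀ ha0 hb0] at hrbta
    nlinarith
  have hz1 : (t + r) / (b + a) ≤ 1 := div_le_one_of_le₀ (by linarith) (by positivity)
  have hup : r / a * (t / b) * ((t + r) / (b + a)) ≤ 1 :=
    mul_le_one₀ (mul_le_one₀ hx1 (by positivity) hy1) (by positivity) hz1
  have hlow : (r / a) ^ 3 ≤ r / a * (t / b) * ((t + r) / (b + a)) := by
    calc (r / a) ^ 3 = r / a * (r / a) * (r / a) := by ring
      _ ≤ _ := by gcongr
  have hcube : 1 - (r / a) ^ 3 ≤ 3 * (1 - r / a) := by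
    nlinarith [mul_nonneg (sub_nonneg.2 hx1) (sub_nonneg.2 hx1), mul_nonneg hx0 hx0,
      mul_nonneg (mul_nonneg (sub_nonneg.2 hx1) (sub_nonneg.2 hx1)) (by linarith : 0 ≤ r / a + 2)]
  have hfac : 0 ≤ (t - r) / (r * t) := div_nonneg (sub_nonneg.2 hrt) (by positivity)
  rw [hdiff, abs_of_nonneg (mul_nonneg hfac (by linarith))]
  gcongr
  linarith

theorem abs_regError_sub_le_of_quadratic {c κ ε r t : ℝ} (hc : 0 < c) (hc1 : c ≤ 1)
    (ht : 0 < t) (hlow : c * t ≤ r) (hrt : r ≤ t) (hκ : t - r ≤ κ * t ^ 2) :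
    |regError ε r - regError ε t| ≤ 3 * κ * (c ^ 3)⁻¹ * (ε ^ 2 / (t ^ 2 + ε ^ 2)) := by
  have hr : 0 < r := lt_of_lt_of_le (by positivity) hlow
  have hκ0 : 0 ≤ κ := by
    by_contra! h
    nlinarith [mul_neg_of_neg_of_pos h (pow_pos ht 2)]
  have h1 : (t - r) / (r * t) ≤ κ * c⁻¹ := by
    calc (t - r) / (r * t) ≤ κ * t ^ 2 / (c * t * t) := by gcongr
      _ = κ * c⁻¹ := by field_simp
  calc |regError ε r - regError ε t|
      ≤ (t - r) / (r * t) * (3 * (ε ^ 2 / (r ^ 2 + ε ^ 2))) := abs_regError_sub_le hr hrt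
    _ ≤ κ * c⁻¹ * (3 * ((c ^ 2)⁻¹ * (ε ^ 2 / (t ^ 2 + ε ^ 2)))) := by
        gcongr
        exact sq_div_le_of_mul_le hc hc1 ht hlow
    _ = 3 * κ * (c ^ 3)⁻¹ * (ε ^ 2 / (t ^ 2 + ε ^ 2)) := by field_simp

theorem integral_sq_div_sq_add_sq_le {ε : ℝ} (hε : 0 < ε) :
    ∫ x in (-(1:ℝ)/2)..(1/2), ε ^ 2 / (x ^ 2 + ε ^ 2) ≤ 4 * ε := by
  have hderiv : ∀ x ∈ Set.uIcc (-(1:ℝ)/2) (1/2),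
      HasDerivAt (fun x => ε * Real.arctan (x / ε)) (ε ^ 2 / (x ^ 2 + ε ^ 2)) x := by
    intro x _
    have h := (((hasDerivAt_id x).div_const ε).arctan).const_mul ε
    refine h.congr_deriv ?_
    simp only [id]
    field_simp
    ring
  have hcont : Continuous fun x : ℝ => ε ^ 2 / (x ^ 2 + ε ^ 2) :=
    continuous_const.div (by fun_prop) fun x => by positivity
  rw [intervalIntegral.integral_eq_sub_of_hasDerivAt hderiv (hcont.intervalIntegrable _ _)]
  have h1 := Real.arctan_lt_pi_div_two (1 / 2 / ε)
  have h2 := Real.neg_pi_div_two_lt_arctan (-(1:ℝ) / 2 / ε)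
  have h3 := Real.pi_lt_four
  nlinarith

theorem continuous_inv_sqrt_sq_add_sq {g : ℝ → ℝ} (hg : Continuous g) {ε : ℝ} (hε : 0 < ε) :
    Continuous fun x => (√(g x ^ 2 + ε ^ 2))⁻¹ :=
  (by fun_prop : Continuous fun x => √(g x ^ 2 + ε ^ 2)).inv₀
    fun x => (Real.sqrt_pos.2 (by positivity)).ne'

theorem integral_inv_sqrt_sq_add_sq {ε : ℝ} (hε : 0 < ε) :
    ∫ x in (-(1:ℝ)/2)..(1/2), (√(x ^ 2 + ε ^ 2))⁻¹
      = 2 * Real.log (1 / 2 + √((1 / 2) ^ 2 + ε ^ 2)) - 2 * Real.log ε := by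
  have hscale : ∀ x : ℝ, √(1 + (x / ε) ^ 2) = √(x ^ 2 + ε ^ 2) / ε := by
    intro x
    rw [Real.sqrt_eq_iff_mul_self_eq (by positivity) (by positivity), div_mul_div_comm,
      Real.mul_self_sqrt (by positivity)]
    field_simp
    ring
  have hderiv : ∀ x ∈ Set.uIcc (-(1:ℝ)/2) (1/2),
      HasDerivAt (fun x => Real.arsinh (x / ε)) ((√(x ^ 2 + ε ^ 2))⁻¹) x := by
    intro x _
    have h := ((hasDerivAt_id x).div_const ε).arsinh
    refine h.congr_deriv ?_
    have : 0 < √(x ^ 2 + ε ^ 2) := Real.sqrt_pos.2 (by positivity)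
    simp only [id, smul_eq_mul]
    rw [hscale]
    field_simp
  rw [intervalIntegral.integral_eq_sub_of_hasDerivAt hderiv
    ((continuous_inv_sqrt_sq_add_sq (g := fun x => x) continuous_id hε).intervalIntegrable _ _),
    neg_div, neg_div, Real.arsinh_neg, Real.arsinh, hscale, ← add_div,
    Real.log_div (by positivity) hε.ne']
  ring

theorem log_half_add_sqrt_mem {ε : ℝ} (hε : 0 < ε) :
    Real.log (1 / 2 + √((1 / 2) ^ 2 + ε ^ 2)) ∈ Set.Icc 0 ε := by
  have h1 : 1 / 2 ≤ √((1 / 2) ^ 2 + ε ^ 2) :=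
    Real.le_sqrt_of_sq_le (by nlinarith [sq_nonneg ε])
  have h2 : √((1 / 2) ^ 2 + ε ^ 2) ≤ 1 / 2 + ε :=
    Real.sqrt_le_iff.2 ⟨by positivity, by nlinarith⟩
  refine ⟨Real.log_nonneg (by linarith), ?_⟩
  have := Real.log_le_sub_one_of_pos (x := 1 / 2 + √((1 / 2) ^ 2 + ε ^ 2)) (by positivity)
  linarith

theorem abs_integral_inv_sqrt_sub_add_log_le {ε δ : ℝ} (hε : 0 < ε) (hδ : 0 < δ) :
    |(∫ x in (-(1:ℝ)/2)..(1/2), ((√(x ^ 2 + δ ^ 2))⁻¹ - (√(x ^ 2 + ε ^ 2))⁻¹))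
        + Real.log (δ ^ 2 / ε ^ 2)| ≤ 2 * (ε + δ) := by
  rw [intervalIntegral.integral_sub
      ((continuous_inv_sqrt_sq_add_sq (g := fun x => x) continuous_id hδ).intervalIntegrable _ _)
      ((continuous_inv_sqrt_sq_add_sq (g := fun x => x) continuous_id hε).intervalIntegrable _ _),
    integral_inv_sqrt_sq_add_sq hε, integral_inv_sqrt_sq_add_sq hδ,
    Real.log_div (by positivity) (by positivity), Real.log_pow, Real.log_pow]
  obtain ⟨h1, h2⟩ := log_half_add_sqrt_mem hε
  obtain ⟨h3, h4⟩ := log_half_add_sqrt_mem hδ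
  push_cast
  rw [abs_le]
  constructor <;> linarith

theorem norm_le_C0norm {f : ℝ → V3} (hf : Continuous f) (hper : ∀ s, f (s + 1) = f s) (s : ℝ) :
    ‖f s‖ ≤ C0norm f := by
  have hp : Function.Periodic f 1 := hper
  obtain ⟨B, hB⟩ := isCompact_Icc.exists_bound_of_continuousOn
    (s := Set.Icc (0:ℝ) (0 + 1)) hf.continuousOn
  refine le_ciSup (f := fun s => ‖f s‖) ⟨B, ?_⟩ s
  rintro _ ⟨x, rfl⟩
  obtain ⟨y, hy, hxy⟩ := hp.exists_mem_Ico one_pos x 0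
  simpa only [hxy] using hB y (Set.Ico_subset_Icc_self hy)

theorem norm_sub_le_C0norm_deriv {f : ℝ → V3} (hf : ContDiff ℝ 1 f)
    (hper : ∀ s, f (s + 1) = f s) (x y : ℝ) :
    ‖f x - f y‖ ≤ C0norm (deriv f) * |x - y| := by
  have hper' : ∀ s, deriv f (s + 1) = deriv f s := fun s => by
    rw [← deriv_comp_add_const f 1 s]
    simp only [hper]
  exact convex_univ.norm_image_sub_le_of_norm_deriv_le
    (fun z _ => (hf.differentiable one_ne_zero).differentiableAt)
    (fun z _ => norm_le_C0norm (hf.continuous_deriv le_rfl) hper' z)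
    (Set.mem_univ y) (Set.mem_univ x)

namespace SlenderGeom

variable {cΓ κmax : ℝ} {X en1 en2 : ℝ → V3}

theorem chord_le (h : SlenderGeom cΓ κmax X en1 en2) (s t : ℝ) : ‖X s - X t‖ ≤ |s - t| := by
  have := convex_univ.norm_image_sub_le_of_norm_deriv_le (f := X) (C := 1)
    (fun z _ => (h.smooth.differentiable two_ne_zero).differentiableAt)
    (fun z _ => (h.arclength z).le) (Set.mem_univ t) (Set.mem_univ s)
  simpa using this

theorem norm_deriv_sub_le (h : SlenderGeom cΓ κmax X en1 en2) (s t : ℝ) :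
    ‖deriv X s - deriv X t‖ ≤ κmax * |s - t| := by
  have hd : ContDiff ℝ 1 (deriv X) := (contDiff_succ_iff_deriv (n := 1)).1 h.smooth |>.2.2
  exact convex_univ.norm_image_sub_le_of_norm_deriv_le
    (fun z _ => (hd.differentiable one_ne_zero).differentiableAt)
    (fun z _ => h.curvature_max z) (Set.mem_univ t) (Set.mem_univ s)

theorem sub_chord_le (h : SlenderGeom cΓ κmax X en1 en2) (s t : ℝ) :
    |s - t| - ‖X s - X t‖ ≤ κmax * |s - t| ^ 2 := by
  have hκ : 0 ≤ κmax := (norm_nonneg _).trans (h.curvature_max s)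
  have hX : Differentiable ℝ X := h.smooth.differentiable two_ne_zero
  have hder : ∀ z, HasDerivAt (fun u => X u - u • deriv X s) (deriv X z - deriv X s) z := by
    intro z
    have h' := (hX z).hasDerivAt.fun_sub ((hasDerivAt_id z).smul_const (deriv X s))
    rwa [one_smul] at h'
  have hbound : ∀ z ∈ Set.uIcc t s, ‖deriv X z - deriv X s‖ ≤ κmax * |s - t| := by
    intro z hz
    refine (h.norm_deriv_sub_le z s).trans (mul_le_mul_of_nonneg_left ?_ hκ)
    rw [abs_sub_comm z s]
    exact Set.abs_sub_right_of_mem_uIcc hz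
  have key := (convex_uIcc t s).norm_image_sub_le_of_norm_hasDerivWithin_le
    (fun z _ => (hder z).hasDerivWithinAt) hbound Set.left_mem_uIcc Set.right_mem_uIcc
  rw [Real.norm_eq_abs] at key
  have hsplit : X s - s • deriv X s - (X t - t • deriv X s)
      = (X s - X t) - (s - t) • deriv X s := by
    rw [sub_smul]; abel
  rw [hsplit] at key
  have htri := norm_sub_norm_le ((s - t) • deriv X s) (X s - X t)
  rw [norm_smul, h.arclength, mul_one, Real.norm_eq_abs,
    norm_sub_rev ((s - t) • deriv X s)] at htri
  nlinarith

end SlenderGeom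

theorem regularized_integrand_error_le {c κ ε δ r x A B : ℝ} {v w : V3} (hc : 0 < c)
    (hc1 : c ≤ 1) (hlow : c * |x| ≤ r) (hr : r ≤ |x|) (hκ : |x| - r ≤ κ * |x| ^ 2)
    (hκ0 : 0 ≤ κ) (hA : ‖v‖ ≤ A) (hB : ‖w - v‖ ≤ B * |x|) (hB0 : 0 ≤ B) :
    ‖((√(r ^ 2 + δ ^ 2))⁻¹ - (√(r ^ 2 + ε ^ 2))⁻¹) • w
        - ((√(x ^ 2 + δ ^ 2))⁻¹ - (√(x ^ 2 + ε ^ 2))⁻¹) • v‖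
      ≤ (1 + 3 * κ) * (c ^ 3)⁻¹ * (A + B)
        * (ε ^ 2 / (x ^ 2 + ε ^ 2) + δ ^ 2 / (x ^ 2 + δ ^ 2)) := by
  have hA0 : 0 ≤ A := (norm_nonneg v).trans hA
  rcases eq_or_ne x 0 with rfl | hx
  · have hr0 : r = 0 := by simp only [abs_zero, mul_zero] at hlow hr; linarith
    have hwv : w = v := by simpa [sub_eq_zero] using hB
    subst hr0 hwv
    rw [sub_self, norm_zero]
    positivity
  have hxp : 0 < |x| := abs_pos.2 hx
  have hrp : 0 < r := lt_of_lt_of_le (by positivity) hlow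
  have hε1 := regError_mul_le (ε := ε) hc hc1 hxp hlow
  have hδ1 := regError_mul_le (ε := δ) hc hc1 hxp hlow
  have hε2 := abs_regError_sub_le_of_quadratic (ε := ε) hc hc1 hxp hlow hr hκ
  have hδ2 := abs_regError_sub_le_of_quadratic (ε := δ) hc hc1 hxp hlow hr hκ
  have hε0 := regError_nonneg (ε := ε) hrp
  have hδ0 := regError_nonneg (ε := δ) hrp
  have hsplit : ((√(r ^ 2 + δ ^ 2))⁻¹ - (√(r ^ 2 + ε ^ 2))⁻¹) • w
        - ((√(x ^ 2 + δ ^ 2))⁻¹ - (√(x ^ 2 + ε ^ 2))⁻¹) • v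
      = (regError ε r - regError δ r) • (w - v)
        + ((regError ε r - regError ε |x|) - (regError δ r - regError δ |x|)) • v := by
    simp only [regError, sq_abs]
    module
  set G := ε ^ 2 / (x ^ 2 + ε ^ 2) + δ ^ 2 / (x ^ 2 + δ ^ 2) with hG
  have hG0 : 0 ≤ G := by positivity
  rw [sq_abs] at hε1 hδ1 hε2 hδ2
  have hfirst : |regError ε r - regError δ r| * |x| ≤ (c ^ 3)⁻¹ * G := by
    calc |regError ε r - regError δ r| * |x| ≤ (regError ε r + regError δ r) * |x| := by
          gcongr
          exact abs_sub_le_iff.2 ⟨by linarith, by linarith⟩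
      _ ≤ (c ^ 3)⁻¹ * G := by rw [hG]; linarith
  have hsecond : |(regError ε r - regError ε |x|) - (regError δ r - regError δ |x|)|
      ≤ 3 * κ * (c ^ 3)⁻¹ * G := by
    refine (abs_sub _ _).trans ?_
    rw [hG]; linarith
  rw [hsplit]
  calc _ ≤ |regError ε r - regError δ r| * ‖w - v‖
        + |(regError ε r - regError ε |x|) - (regError δ r - regError δ |x|)| * ‖v‖ := by
        refine (norm_add_le _ _).trans ?_
        rw [norm_smul, norm_smul, Real.norm_eq_abs, Real.norm_eq_abs]
    _ ≤ |regError ε r - regError δ r| * (B * |x|) + 3 * κ * (c ^ 3)⁻¹ * G * A := by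
        gcongr
    _ = |regError ε r - regError δ r| * |x| * B + 3 * κ * (c ^ 3)⁻¹ * G * A := by ring
    _ ≤ (c ^ 3)⁻¹ * G * B + 3 * κ * (c ^ 3)⁻¹ * G * A := by gcongr
    _ ≤ (1 + 3 * κ) * (c ^ 3)⁻¹ * (A + B) * G := by
        have : 0 ≤ (c ^ 3)⁻¹ * G * A + 3 * κ * ((c ^ 3)⁻¹ * G * B) := by positivity
        linarith

theorem le_mul_abs_log {ε : ℝ} (hε : 0 < ε) (hε' : ε < 1 / 3) : ε ≤ ε * |Real.log ε| := by
  have h : Real.log ε ≤ -1 := by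
    rw [Real.log_le_iff_le_exp hε, Real.exp_neg, ← one_div]
    refine hε'.le.trans (one_div_le_one_div_of_le (Real.exp_pos 1) ?_)
    linarith [Real.exp_one_lt_d9]
  have : 1 ≤ |Real.log ε| := by rw [abs_of_nonpos (by linarith)]; linarith
  nlinarith

/-- First Stokeslet difference term along the centerline:
`|I₁ + log(δ²/ε²) f(s)| ≤ C (ε|log ε| + δ|log δ|) ‖f‖_{C¹}`. -/
theorem centerline_stokeslet_term_I1 (cΓ κmax : ℝ) (hcΓ : 0 < cΓ) :
    ∃ C > 0, ∃ ε₀ > 0,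
      ∀ X en1 en2 : ℝ → V3, SlenderGeom cΓ κmax X en1 en2 →
      ∀ ε δ : ℝ, 0 < ε → ε < ε₀ → 0 < δ → δ < ε₀ →
      ∀ f : ℝ → V3, ContDiff ℝ 1 f → (∀ s, f (s + 1) = f s) →
      ∀ s : ℝ,
        ‖(∫ sb in (-(1:ℝ)/2)..(1/2),
              (((‖X s - X (s - sb)‖ ^ 2 + δ ^ 2) ^ ((1 : ℝ) / 2))⁻¹
                  - ((‖X s - X (s - sb)‖ ^ 2 + ε ^ 2) ^ ((1 : ℝ) / 2))⁻¹) • f (s - sb))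
            + Real.log (δ ^ 2 / ε ^ 2) • f s‖
          ≤ C * (ε * |Real.log ε| + δ * |Real.log δ|) * C1norm f := by
  set c := min cΓ 1
  have hc : 0 < c := lt_min hcΓ one_pos
  have hc1 : c ≤ 1 := min_le_right _ _
  set M := (1 + 3 * |κmax|) * (c ^ 3)⁻¹
  have hM0 : 0 < M := by positivity
  refine ⟨4 * M + 2, by positivity, 1 / 3, by norm_num, ?_⟩
  intro X en1 en2 hX ε δ hε hε₀ hδ hδ₀ f hf hper s
  have hXc : Continuous X := hX.smooth.continuous
  have hfc : Continuous f := hf.continuous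
  have hA : ‖f s‖ ≤ C0norm f := norm_le_C0norm hfc hper s
  have hB0 : 0 ≤ C0norm (deriv f) := by
    simpa using (norm_nonneg _).trans (norm_sub_le_C0norm_deriv hf hper 1 0)
  have hN : 0 ≤ C1norm f := add_nonneg ((norm_nonneg _).trans hA) hB0
  simp only [← Real.sqrt_eq_rpow]
  have hrc : Continuous fun x => ‖X s - X (s - x)‖ := by fun_prop
  have hcont₁ : Continuous fun x => ((√(‖X s - X (s - x)‖ ^ 2 + δ ^ 2))⁻¹
      - (√(‖X s - X (s - x)‖ ^ 2 + ε ^ 2))⁻¹) • f (s - x) :=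
    ((continuous_inv_sqrt_sq_add_sq hrc hδ).sub (continuous_inv_sqrt_sq_add_sq hrc hε)).smul
      (by fun_prop)
  have hcont₂ : Continuous fun x : ℝ => ((√(x ^ 2 + δ ^ 2))⁻¹ - (√(x ^ 2 + ε ^ 2))⁻¹) • f s :=
    ((continuous_inv_sqrt_sq_add_sq continuous_id hδ).sub
      (continuous_inv_sqrt_sq_add_sq continuous_id hε)).smul continuous_const
  have hcontG : ∀ {η : ℝ}, 0 < η → Continuous fun x : ℝ => η ^ 2 / (x ^ 2 + η ^ 2) :=
    fun hη => continuous_const.div (by fun_prop) fun x => by positivity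
  have hpt : ∀ x ∈ Set.Ioc (-(1:ℝ)/2) (1/2),
      ‖((√(‖X s - X (s - x)‖ ^ 2 + δ ^ 2))⁻¹
          - (√(‖X s - X (s - x)‖ ^ 2 + ε ^ 2))⁻¹) • f (s - x)
        - ((√(x ^ 2 + δ ^ 2))⁻¹ - (√(x ^ 2 + ε ^ 2))⁻¹) • f s‖
      ≤ M * C1norm f * (ε ^ 2 / (x ^ 2 + ε ^ 2) + δ ^ 2 / (x ^ 2 + δ ^ 2)) := by
    intro x hx
    have hsx : s - (s - x) = x := sub_sub_cancel s x
    have hx' : |x| ≤ 1 / 2 := abs_le.2 ⟨by linarith [hx.1], hx.2⟩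
    have h1 := hX.no_self_intersect s (s - x) (by rwa [hsx])
    have h2 := hX.chord_le s (s - x)
    have h3 := hX.sub_chord_le s (s - x)
    have h4 := norm_sub_le_C0norm_deriv hf hper (s - x) s
    rw [hsx] at h1 h2 h3
    rw [sub_sub_cancel_left, abs_neg] at h4
    refine regularized_integrand_error_le hc hc1 ?_ h2 ?_ (abs_nonneg κmax) hA h4 hB0
    · exact (mul_le_mul_of_nonneg_right (min_le_left _ _) (abs_nonneg x)).trans h1
    · exact h3.trans (mul_le_mul_of_nonneg_right (le_abs_self _) (by positivity))
  have hmain : ‖∫ x in (-(1:ℝ)/2)..(1/2),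
      (((√(‖X s - X (s - x)‖ ^ 2 + δ ^ 2))⁻¹
          - (√(‖X s - X (s - x)‖ ^ 2 + ε ^ 2))⁻¹) • f (s - x)
        - ((√(x ^ 2 + δ ^ 2))⁻¹ - (√(x ^ 2 + ε ^ 2))⁻¹) • f s)‖
      ≤ M * C1norm f * (4 * ε + 4 * δ) := by
    refine (intervalIntegral.norm_integral_le_of_norm_le (by norm_num)
      (Filter.Eventually.of_forall hpt)
      ((((hcontG hε).add (hcontG hδ)).const_mul _).intervalIntegrable _ _)).trans ?_
    rw [intervalIntegral.integral_const_mul, intervalIntegral.integral_add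
      ((hcontG hε).intervalIntegrable _ _) ((hcontG hδ).intervalIntegrable _ _)]
    gcongr
    · exact integral_sq_div_sq_add_sq_le hε
    · exact integral_sq_div_sq_add_sq_le hδ
  rw [intervalIntegral.integral_sub (hcont₁.intervalIntegrable _ _)
    (hcont₂.intervalIntegrable _ _), intervalIntegral.integral_smul_const] at hmain
  have hlog := abs_integral_inv_sqrt_sub_add_log_le hε hδ
  set I := ∫ x in (-(1:ℝ)/2)..(1/2), ((√(x ^ 2 + δ ^ 2))⁻¹ - (√(x ^ 2 + ε ^ 2))⁻¹)
  set J := ∫ x in (-(1:ℝ)/2)..(1/2), ((√(‖X s - X (s - x)‖ ^ 2 + δ ^ 2))⁻¹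
      - (√(‖X s - X (s - x)‖ ^ 2 + ε ^ 2))⁻¹) • f (s - x)
  have hfs : ‖f s‖ ≤ C1norm f := hA.trans (le_add_of_nonneg_right hB0)
  calc ‖J + Real.log (δ ^ 2 / ε ^ 2) • f s‖
      = ‖(J - I • f s) + (I + Real.log (δ ^ 2 / ε ^ 2)) • f s‖ := by congr 1; module
    _ ≤ M * C1norm f * (4 * ε + 4 * δ) + 2 * (ε + δ) * C1norm f := by
        refine (norm_add_le _ _).trans (add_le_add hmain ?_)
        rw [norm_smul, Real.norm_eq_abs]
        gcongr
    _ = (4 * M + 2) * (ε + δ) * C1norm f := by ring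
    _ ≤ _ := by
        gcongr
        · exact le_mul_abs_log hε hε₀
        · exact le_mul_abs_log hδ hδ₀
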